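/- arXiv:2502.01604 — 3 statements merged into one kernel-verified Lean document; each statement's English description precedes it below -/
import Mathlib

section
/- Let (P, ≤) be a partially ordered set and let P̃ = {(x,y) ∈ P × P : x ≠ y}. Define the relation ≤_E on P̃ by (x,y) ≤_E (u,v) iff (x = u and y ≤ v) or (y = v and u ≤ x). Then the reflexive-transitive closure ⪯_E of ≤_E is antisymmetric; hence (P̃, ⪯_E) is a partially ordered set. -/
/-- The set `P̃` of ordered pairs of distinct elements of `P`. -/
abbrev Pairs (P : Type*) := {p : P × P // p.1 ≠ p.2}

/-- The relation `≤_E` on `P̃`: `(x,y) ≤_E (u,v)` iff (`x = u` and `y ≤ v`) or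
(`y = v` and `u ≤ x`). -/
def leE {P : Type*} [PartialOrder P] (a b : Pairs P) : Prop :=
  (a.1.1 = b.1.1 ∧ a.1.2 ≤ b.1.2) ∨ (a.1.2 = b.1.2 ∧ b.1.1 ≤ a.1.1)

/-- Along `⪯_E` the first coordinate decreases and the second increases. -/
theorem le_and_le_of_reflTransGen_leE {P : Type*} [PartialOrder P] {a b : Pairs P}
    (h : Relation.ReflTransGen leE a b) : b.1.1 ≤ a.1.1 ∧ a.1.2 ≤ b.1.2 := by
  induction h with
  | refl => exact ⟨le_rfl, le_rfl⟩
  | tail _ hbc ih =>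
    rcases hbc with ⟨h₁, h₂⟩ | ⟨h₁, h₂⟩
    · exact ⟨h₁.ge.trans ih.1, ih.2.trans h₂⟩
    · exact ⟨h₂.trans ih.1, ih.2.trans h₁.le⟩

theorem reflTransGen_leE_antisymm {P : Type*} [PartialOrder P] {a b : Pairs P}
    (hab : Relation.ReflTransGen leE a b) (hba : Relation.ReflTransGen leE b a) : a = b := by
  have h₁ := le_and_le_of_reflTransGen_leE hab
  have h₂ := le_and_le_of_reflTransGen_leE hba
  exact Subtype.ext (Prod.ext (h₂.1.antisymm h₁.1) (h₁.2.antisymm h₂.2))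

/-- The reflexive-transitive closure `⪯_E` of `≤_E` is antisymmetric, hence
`(P̃, ⪯_E)` is a partially ordered set. -/
theorem stmt_5 {P : Type*} [PartialOrder P] :
    (∀ a b : Pairs P, Relation.ReflTransGen leE a b →
      Relation.ReflTransGen leE b a → a = b) ∧
    IsPartialOrder (Pairs P) (Relation.ReflTransGen leE) := by
  refine ⟨fun _ _ => reflTransGen_leE_antisymm, ?_⟩
  exact
    { refl := fun _ => .refl
      trans := fun _ _ _ => .trans
      antisymm := fun _ _ => reflTransGen_leE_antisymm }
end

section
/- Let (P, ≤) be a partially ordered set. A function π : P × P → ℝ is a probability function on P if and only if all of the following hold: π(x,y) = 1 whenever x ≤ y; π(x,y) = 0 whenever y < x; for every pair of incomparable elements x ∥ y one has 0 ≤ π(x,y) ≤ 1 and π(x,y) + π(y,x) = 1; and for all pairs of incomparable elements (x,y), (u,v) with (x,y) ≤_A (u,v) one has π(x,y) ≤ π(u,v). (This identifies the set of probability functions on P with the intersection of the order polytope of (A₂(P), ⪯_A) with the affine subspace given by the equations π(x,y) + π(y,x) = 1 for x ∥ y.) -/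
/-- A probability function on a poset `P` (Kim–Kim–Neggers): a function
`π : P × P → ℝ` with values in `[0,1]` such that `π(x,x) = 1`, `x ≤ y` implies
`π(x,y) = 1`, `x ≠ y` implies `π(x,y) + π(y,x) = 1`, and `y < z` implies
`π(x,y) ≤ π(x,z)`. -/
def IsProbFunc {P : Type*} [PartialOrder P] (π : P → P → ℝ) : Prop :=
  (∀ x y : P, 0 ≤ π x y ∧ π x y ≤ 1) ∧
  (∀ x : P, π x x = 1) ∧
  (∀ x y : P, x ≤ y → π x y = 1) ∧
  (∀ x y : P, x ≠ y → π x y + π y x = 1) ∧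
  (∀ x y z : P, y < z → π x y ≤ π x z)


/-- `π : P × P → ℝ` is a probability function on `P` iff: `π(x,y) = 1`
whenever `x ≤ y`; `π(x,y) = 0` whenever `y < x`; for every pair of
incomparable elements, `0 ≤ π(x,y) ≤ 1` and `π(x,y) + π(y,x) = 1`; and for all
pairs of incomparable elements with `(x,y) ≤_A (u,v)` (i.e. `x = u ∧ y ≤ v`
or `y = v ∧ u ≤ x`), `π(x,y) ≤ π(u,v)`.  This identifies the set of
probability functions on `P` with the intersection of the order polytope of
`(A₂(P), ⪯_A)` with the affine subspace `π(x,y) + π(y,x) = 1` for `x ∥ y`. -/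
theorem stmt_16 {P : Type*} [PartialOrder P] (π : P → P → ℝ) :
    IsProbFunc π ↔
      ((∀ x y : P, x ≤ y → π x y = 1) ∧
       (∀ x y : P, y < x → π x y = 0) ∧
       (∀ x y : P, ¬x ≤ y → ¬y ≤ x →
          (0 ≤ π x y ∧ π x y ≤ 1) ∧ π x y + π y x = 1) ∧
       (∀ x y u v : P, (¬x ≤ y ∧ ¬y ≤ x) → (¬u ≤ v ∧ ¬v ≤ u) →
          ((x = u ∧ y ≤ v) ∨ (y = v ∧ u ≤ x)) → π x y ≤ π u v)) := by
  constructor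
  · rintro ⟨hbd, -, hle, hadd, hmono⟩
    refine ⟨hle, fun x y hyx => ?_, fun x y hxy _ => ⟨hbd x y, hadd x y fun h => hxy h.le⟩, ?_⟩
    · linarith [hadd x y hyx.ne', hle y x hyx.le]
    · rintro x y u v ⟨hxy, -⟩ ⟨huv, -⟩ (⟨rfl, hyv⟩ | ⟨rfl, hux⟩)
      · rcases hyv.eq_or_lt with rfl | hlt
        · exact le_rfl
        · exact hmono x y v hlt
      · rcases hux.eq_or_lt with rfl | hlt
        · exact le_rfl
        · linarith [hmono y u x hlt, hadd x y fun h => hxy h.le, hadd u y fun h => huv h.le]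
  · rintro ⟨hone, hzero, hinc, hmono⟩
    have hbd : ∀ x y : P, 0 ≤ π x y ∧ π x y ≤ 1 := by
      intro x y
      by_cases hxy : x ≤ y
      · simp [hone x y hxy]
      by_cases hyx : y ≤ x
      · simp [hzero x y (lt_of_le_not_ge hyx hxy)]
      · exact (hinc x y hxy hyx).1
    refine ⟨hbd, fun x => hone x x le_rfl, hone, fun x y hne => ?_, fun x y z hyz => ?_⟩
    · by_cases hxy : x ≤ y
      · simp [hone x y hxy, hzero y x (lt_of_le_of_ne hxy hne)]
      by_cases hyx : y ≤ x
      · simp [hone y x hyx, hzero x y (lt_of_le_not_ge hyx hxy)]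
      · exact (hinc x y hxy hyx).2
    · by_cases hxz : x ≤ z
      · exact (hbd x y).2.trans_eq (hone x z hxz).symm
      have hxy : ¬x ≤ y := fun h => hxz (h.trans hyz.le)
      by_cases hyx : y ≤ x
      · exact (hzero x y (lt_of_le_not_ge hyx hxy)).trans_le (hbd x z).1
      · exact hmono x y x z ⟨hxy, hyx⟩ ⟨hxz, fun h => hyx (hyz.le.trans h)⟩
          (Or.inl ⟨rfl, hyz.le⟩)
end

section
/- Let P = Bool × Bool × Bool with the componentwise (product) order, i.e., P is the poset C₂ × C₂ × C₂. Then the probability function ν on P, defined by ν(x,y) = 1 if x ≤ y, ν(x,y) = 1/2 if x and y are incomparable, and ν(x,y) = 0 if x > y, is an extreme point of the convex set of all probability functions on P. In particular, the set of probability functions on P has an extreme point with a coordinate not in {0,1}, so it is not a 0/1-polytope. -/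
/-- A probability function on the Boolean cube that is constant along pairs `y ≤ z` of elements
both incomparable to `x` takes the value `1 / 2` at every incomparable pair. -/
theorem IsProbFunc.eq_half_of_incomparable {π : Bool × Bool × Bool → Bool × Bool × Bool → ℝ}
    (hπ : IsProbFunc π)
    (hconst : ∀ x y z, y ≤ z → ¬ x ≤ y → ¬ y ≤ x → ¬ x ≤ z → ¬ z ≤ x → π x y = π x z)
    {x y : Bool × Bool × Bool} (hxy : ¬ x ≤ y) (hyx : ¬ y ≤ x) : π x y = 1 / 2 := by
  obtain ⟨-, -, -, hadd, -⟩ := hπ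
  have htri : ∀ a b c, a ≠ b → b ≠ c → c ≠ a →
      π a b = π a c → π b c = π b a → π c a = π c b →
      π a b = 1 / 2 ∧ π b c = 1 / 2 ∧ π c a = 1 / 2 := by
    intro a b c hab hbc hca h₁ h₂ h₃
    refine ⟨?_, ?_, ?_⟩ <;> linarith [hadd a b hab, hadd b c hbc, hadd c a hca]
  have hup : ∀ x y z w, (y ≤ z ∧ w ≤ z ∧ ¬ x ≤ y ∧ ¬ y ≤ x ∧ ¬ x ≤ z ∧ ¬ z ≤ x ∧
      ¬ x ≤ w ∧ ¬ w ≤ x) → π x y = π x w := fun x y z w ⟨hyz, hwz, h₁, h₂, h₃, h₄, h₅, h₆⟩ =>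
    (hconst x y z hyz h₁ h₂ h₃ h₄).trans (hconst x w z hwz h₅ h₆ h₃ h₄).symm
  have hdown : ∀ x y z w, (z ≤ y ∧ z ≤ w ∧ ¬ x ≤ y ∧ ¬ y ≤ x ∧ ¬ x ≤ z ∧ ¬ z ≤ x ∧
      ¬ x ≤ w ∧ ¬ w ≤ x) → π x y = π x w := fun x y z w ⟨hzy, hzw, h₁, h₂, h₃, h₄, h₅, h₆⟩ =>
    (hconst x z y hzy h₃ h₄ h₁ h₂).symm.trans (hconst x z w hzw h₃ h₄ h₅ h₆)
  let a : Bool × Bool × Bool := (true, false, false)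
  let b : Bool × Bool × Bool := (false, true, false)
  let c : Bool × Bool × Bool := (false, false, true)
  let ab : Bool × Bool × Bool := (true, true, false)
  let bc : Bool × Bool × Bool := (false, true, true)
  let ca : Bool × Bool × Bool := (true, false, true)
  obtain ⟨hab, hbc, hca⟩ := htri a b c (by decide) (by decide) (by decide)
    (hup a b bc c (by decide))
    (hup b c ca a (by decide))
    (hup c a ab b (by decide))
  obtain ⟨hab', hbc', hca'⟩ := htri ab bc ca (by decide) (by decide) (by decide)
    (hdown ab bc c ca (by decide))
    (hdown bc ca a ab (by decide))
    (hdown ca ab b bc (by decide))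
  have ha := hconst a b bc (by decide) (by decide) (by decide) (by decide) (by decide)
  have hb := hconst b c ca (by decide) (by decide) (by decide) (by decide) (by decide)
  have hc := hconst c a ab (by decide) (by decide) (by decide) (by decide) (by decide)
  have hne : x ≠ y := fun h => hxy h.le
  have hsum := hadd x y hne
  simp only [a, b, c, ab, bc, ca] at *
  obtain ⟨_ | _, _ | _, _ | _⟩ := x <;> obtain ⟨_ | _, _ | _, _ | _⟩ := y <;>
    first
    | exact absurd (by decide) hxy
    | exact absurd (by decide) hyx
    | linarith

/-- The function equal to `1 / 2` at incomparable pairs is a probability function on any poset. -/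
theorem isProbFunc_half {P : Type*} [PartialOrder P] [DecidableLE P] :
    IsProbFunc fun x y : P => if x ≤ y then (1 : ℝ) else if y ≤ x then 0 else 1 / 2 := by
  refine ⟨fun x y => ?_, fun x => ?_, fun x y h => ?_, fun x y h => ?_, fun x y z h => ?_⟩
  · dsimp only
    split_ifs <;> norm_num
  · simp
  · simp [h]
  · by_cases hxy : x ≤ y <;> by_cases hyx : y ≤ x
    · exact absurd (le_antisymm hxy hyx) h
    all_goals norm_num [hxy, hyx]
  · by_cases hxy : x ≤ y
    · simp [hxy, hxy.trans h.le]
    · by_cases hzx : z ≤ x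
      · simp only [hxy, h.le.trans hzx, if_true, if_false]
        split_ifs <;> norm_num
      · dsimp only
        split_ifs <;> norm_num

open Classical in
/-- For `P = Bool × Bool × Bool` with the componentwise order (the poset
`C₂ × C₂ × C₂`), the probability function `ν` — with `ν(x,y) = 1` if `x ≤ y`,
`ν(x,y) = 0` if `x > y`, and `ν(x,y) = 1/2` if `x ∥ y` — is an extreme point
of the convex set of probability functions on `P`.  In particular this set has
an extreme point with a coordinate not in `{0,1}`: it is not a 0/1-polytope. -/
theorem stmt_19 :
    (fun x y : Bool × Bool × Bool =>
        if x ≤ y then (1 : ℝ) else if y ≤ x then 0 else 1 / 2) ∈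
      Set.extremePoints ℝ
        {π : Bool × Bool × Bool → Bool × Bool × Bool → ℝ | IsProbFunc π} ∧
    (∃ x y : Bool × Bool × Bool,
      (if x ≤ y then (1 : ℝ) else if y ≤ x then 0 else 1 / 2) ≠ 0 ∧
      (if x ≤ y then (1 : ℝ) else if y ≤ x then 0 else 1 / 2) ≠ 1) := by
  refine ⟨⟨isProbFunc_half, ?_⟩, (true, false, false), (false, true, false), ?_⟩
  · rintro π hπ ρ hρ ⟨s, t, hs, ht, -, hν⟩
    have happ : ∀ x y, s * π x y + t * ρ x y =
        if x ≤ y then (1 : ℝ) else if y ≤ x then 0 else 1 / 2 :=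
      fun x y => congr_fun (congr_fun hν x) y
    have hconst : ∀ x y z, y ≤ z → ¬ x ≤ y → ¬ y ≤ x → ¬ x ≤ z → ¬ z ≤ x →
        π x y = π x z := by
      intro x y z hyz h₁ h₂ h₃ h₄
      obtain rfl | hyz := hyz.eq_or_lt
      · rfl
      have hy := happ x y
      have hz := happ x z
      simp only [h₁, h₂, h₃, h₄, if_false] at hy hz
      have hπle := hπ.2.2.2.2 x y z hyz
      have hρle := hρ.2.2.2.2 x y z hyz
      refine le_antisymm hπle (le_of_mul_le_mul_left ?_ hs)
      linarith [mul_le_mul_of_nonneg_left hρle ht.le]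
    funext x y
    by_cases hxy : x ≤ y
    · simpa [hxy] using hπ.2.2.1 x y hxy
    · by_cases hyx : y ≤ x
      · have hadd := hπ.2.2.2.1 x y fun h => hxy h.le
        rw [hπ.2.2.1 y x hyx] at hadd
        simpa [hxy, hyx] using hadd
      · simpa [hxy, hyx] using hπ.eq_half_of_incomparable hconst hxy hyx
  · have h₁ : ¬ ((true, false, false) : Bool × Bool × Bool) ≤ (false, true, false) := by decide
    have h₂ : ¬ ((false, true, false) : Bool × Bool × Bool) ≤ (true, false, false) := by decide
    norm_num [h₁, h₂]
end
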